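/- arXiv:math/0612538 — 6 statements merged into one kernel-verified Lean document; each statement's English description precedes it below -/
import Mathlib

section
/- Let $C\subseteq\mathbb{R}^d$ be a pointed full-dimensional rational cone, and let $S_1,\dots,S_n$ be $f$-subcones of $C$, each containing a given $d$-dimensional subcone $D$ of $C$. If every residue class of $\mathbb{Z}^d$ modulo $\Gamma(S_1)\cap\dots\cap\Gamma(S_n)$ meets $\Gamma(S_1)\cup\dots\cup\Gamma(S_n)$, then every lattice point $x\in D\cap\mathbb{Z}^d$ lies in $\Sigma(S_i)$ for some $i$ (i.e., $D$ is $f$-covered by $S_1,\dots,S_n$). -/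
/-- The real vector corresponding to an integer vector. -/
def toR {d : ℕ} (x : Fin d → ℤ) : Fin d → ℝ := fun i => (x i : ℝ)

/-- The cone generated by a finite family of integer vectors. -/
def coneFin {d n : ℕ} (v : Fin n → (Fin d → ℤ)) : Set (Fin d → ℝ) :=
  { y | ∃ a : Fin n → ℝ, (∀ i, 0 ≤ a i) ∧ y = ∑ i, a i • toR (v i) }

/-- The cone generated by a set of integer vectors (nonnegative real combinations
of finitely many of its elements). -/
def coneSet {d : ℕ} (B : Set (Fin d → ℤ)) : Set (Fin d → ℝ) :=
  { y | ∃ (n : ℕ) (v : Fin n → (Fin d → ℤ)) (a : Fin n → ℝ),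
      (∀ i, v i ∈ B) ∧ (∀ i, 0 ≤ a i) ∧ y = ∑ i, a i • toR (v i) }

/-- A finitely generated rational cone. -/
def IsRatCone {d : ℕ} (C : Set (Fin d → ℝ)) : Prop :=
  ∃ B : Finset (Fin d → ℤ), C = coneSet (B : Set (Fin d → ℤ))

/-- A pointed cone: `x, -x ∈ C` implies `x = 0`. -/
def PointedSet {d : ℕ} (C : Set (Fin d → ℝ)) : Prop :=
  ∀ x ∈ C, -x ∈ C → x = 0

/-- A full-dimensional subset of `ℝ^d`. -/
def FullDim {d : ℕ} (C : Set (Fin d → ℝ)) : Prop :=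
  Submodule.span ℝ C = ⊤

/-- The Hilbert basis of the monoid `C ∩ ℤ^d`: the nonzero lattice points of `C`
admitting no decomposition into two nonzero lattice points of `C`. -/
def hilbC {d : ℕ} (C : Set (Fin d → ℝ)) : Set (Fin d → ℤ) :=
  { z | toR z ∈ C ∧ z ≠ 0 ∧
    ¬∃ u v : Fin d → ℤ, toR u ∈ C ∧ toR v ∈ C ∧ u ≠ 0 ∧ v ≠ 0 ∧ z = u + v }

/-- A lattice point of a simplicial cone that lies in the subgroup generated by the linearly
independent generators of the cone lies in the submonoid they generate. -/
theorem mem_closure_of_mem_coneFin {d m : ℕ} {g : Fin m → (Fin d → ℤ)}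
    (hg : LinearIndependent ℝ (fun k => toR (g k))) {v : Fin d → ℤ}
    (hv : v ∈ AddSubgroup.closure (Set.range g)) (hvC : toR v ∈ coneFin g) :
    v ∈ AddSubmonoid.closure (Set.range g) := by
  obtain ⟨a, ha, hva⟩ := hvC
  rw [← Submodule.span_int_eq_addSubgroupClosure, Submodule.mem_toAddSubgroup,
    Submodule.mem_span_range_iff_exists_fun] at hv
  obtain ⟨c, hc⟩ := hv
  have hcR : toR v = ∑ k, (c k : ℝ) • toR (g k) := by
    ext i
    simp [← hc, toR, Finset.sum_apply]
  have hca : ∀ k, (c k : ℝ) = a k := by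
    intro k
    refine sub_eq_zero.mp (Fintype.linearIndependent_iff.mp hg (fun k => (c k : ℝ) - a k) ?_ k)
    simp only [sub_smul, Finset.sum_sub_distrib]
    rw [← hcR, ← hva, sub_self]
  rw [← hc]
  refine sum_mem fun k _ => ?_
  have hk : 0 ≤ c k := by
    have := ha k
    rw [← hca k] at this
    exact_mod_cast this
  rw [← Int.toNat_of_nonneg hk, natCast_zsmul]
  exact nsmul_mem (AddSubmonoid.subset_closure (Set.mem_range_self k)) _

/-- Lemma 3.1(b): if `S₁,…,Sₙ` are f-subcones of `C` (generated by linearly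
independent Hilbert basis elements `x j 0, …, x j (d-1)`), each containing a
`d`-dimensional subcone `D` of `C`, and every residue class of `ℤ^d` modulo
`Γ(S₁) ∩ ⋯ ∩ Γ(Sₙ)` meets `Γ(S₁) ∪ ⋯ ∪ Γ(Sₙ)`, then `D` is f-covered. -/
theorem fcovered_of_residue_classes {d n : ℕ} (C D : Set (Fin d → ℝ))
    (hC : IsRatCone C) (hCp : PointedSet C) (hCf : FullDim C)
    (hD : IsRatCone D) (hDC : D ⊆ C) (hDf : FullDim D)
    (x : Fin n → Fin d → (Fin d → ℤ))
    (hhilb : ∀ j k, x j k ∈ hilbC C)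
    (hind : ∀ j, LinearIndependent ℝ (fun k => toR (x j k)))
    (hDS : ∀ j, D ⊆ coneFin (x j))
    (hres : ∀ y : Fin d → ℤ, ∃ w : Fin d → ℤ,
      (w - y ∈ ⨅ j, AddSubgroup.closure (Set.range (x j))) ∧
      ∃ j, w ∈ AddSubgroup.closure (Set.range (x j))) :
    ∀ v : Fin d → ℤ, toR v ∈ D →
      ∃ j, v ∈ AddSubmonoid.closure (Set.range (x j)) := by
  intro v hv
  obtain ⟨w, hwv, j, hw⟩ := hres v
  refine ⟨j, mem_closure_of_mem_coneFin (hind j) ?_ (hDS j hv)⟩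
  have hj := AddSubgroup.mem_iInf.mp hwv j
  simpa using sub_mem hw hj
end

section
/- Let $C\subseteq\mathbb{R}^d$ be a pointed full-dimensional rational cone and let $D$ be a $d$-dimensional subcone of $C$ with the property that for every $f$-subcone $S$ of $C$, either $D\subseteq S$ or $\operatorname{int}(D)\cap\operatorname{int}(S)=\emptyset$. Let $G_D$ be the intersection of the groups $\Gamma(S)$ over all $f$-subcones $S\supseteq D$, and let $H_D$ be their union. Then every lattice point of $D$ lies in $\Sigma(S)$ for some $f$-subcone $S$ of $C$ (i.e., $D$ is $f$-covered) if and only if every residue class of $\mathbb{Z}^d$ modulo $G_D$ meets $H_D$. -/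
/-- An f-subcone of `C`, described by its generating family: `d` linearly
independent elements of the Hilbert basis of `C`. -/
def IsFSubconeFam {d : ℕ} (C : Set (Fin d → ℝ)) (y : Fin d → (Fin d → ℤ)) : Prop :=
  (∀ k, y k ∈ hilbC C) ∧ LinearIndependent ℝ (fun k => toR (y k))

section toR

variable {d : ℕ}

@[simp]
lemma toR_apply (x : Fin d → ℤ) (i : Fin d) : toR x i = (x i : ℝ) := rfl

lemma toR_add (x y : Fin d → ℤ) : toR (x + y) = toR x + toR y := by
  ext i; simp

lemma toR_sub (x y : Fin d → ℤ) : toR (x - y) = toR x - toR y := by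
  ext i; simp

lemma toR_zsmul (n : ℤ) (x : Fin d → ℤ) : toR (n • x) = (n : ℝ) • toR x := by
  ext i; simp

lemma toR_sum {ι : Type*} (s : Finset ι) (f : ι → Fin d → ℤ) :
    toR (∑ i ∈ s, f i) = ∑ i ∈ s, toR (f i) := by
  ext i; simp

end toR

/-- A cone generated by a finite set, described by coefficients indexed by the generators. -/
lemma mem_coneSet_finset_iff {d : ℕ} {B : Finset (Fin d → ℤ)} {y : Fin d → ℝ} :
    y ∈ coneSet (B : Set (Fin d → ℤ)) ↔
      ∃ c : (Fin d → ℤ) → ℝ, (∀ b, 0 ≤ c b) ∧ y = ∑ b ∈ B, c b • toR b := by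
  classical
  constructor
  · rintro ⟨n, v, a, hv, ha, rfl⟩
    refine ⟨fun b => ∑ i with v i = b, a i, fun b => Finset.sum_nonneg fun i _ => ha i, ?_⟩
    rw [← Finset.sum_fiberwise_of_maps_to (s := Finset.univ) (t := B) (g := v)
      (fun i _ => by simpa using hv i)]
    refine Finset.sum_congr rfl fun b _ => ?_
    rw [Finset.sum_smul]
    refine Finset.sum_congr rfl fun i hi => ?_
    rw [(Finset.mem_filter.mp hi).2]
  · rintro ⟨c, hc, rfl⟩
    refine ⟨B.card, fun i => (B.equivFin.symm i : Fin d → ℤ),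
      fun i => c (B.equivFin.symm i), fun i => by simp, fun i => hc _, ?_⟩
    rw [← Finset.sum_coe_sort B (fun b => c b • toR b)]
    exact (Equiv.sum_comp B.equivFin.symm (fun b : B => c b • toR (b : Fin d → ℤ))).symm

/-- Gordan's lemma: the Hilbert basis of a rational cone is finite. -/
lemma IsRatCone.finite_hilbC {d : ℕ} {C : Set (Fin d → ℝ)} (hC : IsRatCone C) :
    (hilbC C).Finite := by
  classical
  obtain ⟨B, rfl⟩ := hC
  set M : Fin d → ℤ := fun j => ∑ b ∈ B, |b j|
  refine (B.finite_toSet.union (Set.finite_Icc (-M) M)).subset ?_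
  rintro z ⟨hz, -, hirr⟩
  obtain ⟨c, hc, hzc⟩ := mem_coneSet_finset_iff.mp hz
  by_cases h : ∃ b ∈ B, b ≠ 0 ∧ 1 ≤ c b
  · obtain ⟨b, hb, hb0, hcb⟩ := h
    left
    by_contra hzB
    refine hirr ⟨b, z - b, mem_coneSet_finset_iff.mpr ⟨fun x => if x = b then 1 else 0,
      fun x => by positivity, by simp [hb]⟩, mem_coneSet_finset_iff.mpr
      ⟨fun x => c x - if x = b then 1 else 0, fun x => ?_, ?_⟩, hb0, ?_, by simp⟩
    · by_cases hx : x = b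
      · subst hx; simpa using hcb
      · simpa [hx] using hc x
    · simp [toR_sub, hzc, sub_smul, Finset.sum_sub_distrib, hb]
    · rintro h0
      rw [sub_eq_zero] at h0
      exact hzB (h0 ▸ hb)
  · push Not at h
    right
    have key : ∀ j, |z j| ≤ M j := fun j => by
      have hj : (z j : ℝ) = ∑ b ∈ B, c b * (b j : ℝ) := by
        simpa using congrFun hzc j
      have : |(z j : ℝ)| ≤ ∑ b ∈ B, |(b j : ℝ)| := by
        rw [hj]
        refine (Finset.abs_sum_le_sum_abs _ _).trans (Finset.sum_le_sum fun b hb => ?_)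
        by_cases hb0 : b = 0
        · simp [hb0]
        · rw [abs_mul, abs_of_nonneg (hc b)]
          exact mul_le_of_le_one_left (abs_nonneg _) (h b hb hb0).le
      simp only [M]
      exact_mod_cast this
    exact ⟨fun j => (abs_le.mp (key j)).1, fun j => (abs_le.mp (key j)).2⟩

/-- The group generated by `d` linearly independent vectors of `ℤ^d` contains a positive
multiple of `ℤ^d`. -/
lemma exists_pos_zsmul_mem_closure {d : ℕ} {y : Fin d → Fin d → ℤ}
    (hy : LinearIndependent ℝ (fun k => toR (y k))) :
    ∃ N : ℤ, 0 < N ∧ ∀ x : Fin d → ℤ, N • x ∈ AddSubgroup.closure (Set.range y) := by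
  set A : Matrix (Fin d) (Fin d) ℤ := Matrix.of y
  have hdet : A.det ≠ 0 := by
    have hu : IsUnit (A.map (Int.castRingHom ℝ)) :=
      Matrix.linearIndependent_rows_iff_isUnit.mp hy
    rw [Matrix.isUnit_iff_isUnit_det, isUnit_iff_ne_zero] at hu
    intro h0
    apply hu
    have := RingHom.map_det (Int.castRingHom ℝ) A
    rw [h0] at this
    simpa using this.symm
  have hmem : ∀ x : Fin d → ℤ, A.det • x ∈ AddSubgroup.closure (Set.range y) := fun x => by
    have h : A.det • x = ∑ i, Matrix.vecMul x A.adjugate i • y i := by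
      have : A.det • x = Matrix.vecMul (Matrix.vecMul x A.adjugate) A := by
        rw [Matrix.vecMul_vecMul, Matrix.adjugate_mul, Matrix.vecMul_smul, Matrix.vecMul_one]
      rw [this, Matrix.vecMul_eq_sum]
      rfl
    rw [h]
    exact sum_mem fun i _ => zsmul_mem (AddSubgroup.subset_closure (Set.mem_range_self i)) _
  refine ⟨|A.det|, abs_pos.mpr hdet, fun x => ?_⟩
  rcases abs_choice A.det with h | h <;> rw [h]
  · exact hmem x
  · rw [neg_smul]
    exact neg_mem (hmem x)

/-- A uniform positive multiple of `ℤ^d` lies in the group of every f-subcone. -/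
lemma IsRatCone.exists_pos_zsmul_mem {d : ℕ} {C : Set (Fin d → ℝ)} (hC : IsRatCone C) :
    ∃ N : ℤ, 0 < N ∧ ∀ y, IsFSubconeFam C y → ∀ x : Fin d → ℤ,
      N • x ∈ AddSubgroup.closure (Set.range y) := by
  have hfin : {y | IsFSubconeFam C y}.Finite :=
    (Set.Finite.pi' (fun _ : Fin d => hC.finite_hilbC)).subset fun y hy => hy.1
  have hex : ∀ y, IsFSubconeFam C y → ∃ N : ℤ, 0 < N ∧ ∀ x : Fin d → ℤ,
      N • x ∈ AddSubgroup.closure (Set.range y) := fun y hy => exists_pos_zsmul_mem_closure hy.2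
  choose! N hN hmem using hex
  refine ⟨∏ y ∈ hfin.toFinset, N y, Finset.prod_pos fun y hy => hN y (by simpa using hy),
    fun y hy x => ?_⟩
  obtain ⟨m, hm⟩ := Finset.dvd_prod_of_mem N (hfin.mem_toFinset.mpr hy)
  rw [hm, mul_smul]
  exact hmem y hy _

/-- The basis of `ℝ^d` given by `d` linearly independent integer vectors. -/
noncomputable def basisOfInt {d : ℕ} {y : Fin d → Fin d → ℤ}
    (hy : LinearIndependent ℝ (fun k => toR (y k))) : Module.Basis (Fin d) ℝ (Fin d → ℝ) :=
  basisOfLinearIndependentOfCardEqFinrank' _ hy (by simp)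

section basisOfInt

variable {d : ℕ} {y : Fin d → Fin d → ℤ}

lemma basisOfInt_apply (hy : LinearIndependent ℝ (fun k => toR (y k)))
    (i : Fin d) : basisOfInt hy i = toR (y i) := by
  simp [basisOfInt]

lemma basisOfInt_repr_sum (hy : LinearIndependent ℝ (fun k => toR (y k)))
    (a : Fin d → ℝ) (i : Fin d) :
    (basisOfInt hy).repr (∑ i, a i • toR (y i)) i = a i := by
  simp_rw [← basisOfInt_apply hy]
  rw [Module.Basis.repr_sum_self]

lemma mem_coneFin_iff_repr_nonneg (hy : LinearIndependent ℝ (fun k => toR (y k)))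
    {x : Fin d → ℝ} :
    x ∈ coneFin y ↔ ∀ i, 0 ≤ (basisOfInt hy).repr x i := by
  constructor
  · rintro ⟨a, ha, rfl⟩ i
    rw [basisOfInt_repr_sum]
    exact ha i
  · intro h
    refine ⟨fun i => (basisOfInt hy).repr x i, h, ?_⟩
    simp_rw [← basisOfInt_apply hy]
    exact ((basisOfInt hy).sum_repr x).symm

lemma mem_interior_coneFin_of_repr_pos (hy : LinearIndependent ℝ (fun k => toR (y k)))
    {x : Fin d → ℝ}
    (hx : ∀ i, 0 < (basisOfInt hy).repr x i) : x ∈ interior (coneFin y) := by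
  have hopen : IsOpen {x : Fin d → ℝ | ∀ i, 0 < (basisOfInt hy).repr x i} := by
    simp only [Set.ofPred_forall]
    exact isOpen_iInter_of_finite fun i => isOpen_lt continuous_const
      (LinearMap.continuous_of_finiteDimensional ((basisOfInt hy).coord i))
  exact interior_maximal
    (fun z hz => (mem_coneFin_iff_repr_nonneg hy).mpr fun i => (hz i).le) hopen hx

/-- An open set meeting a simplicial cone meets its interior. -/
lemma nonempty_inter_interior_coneFin (hy : LinearIndependent ℝ (fun k => toR (y k)))
    {U : Set (Fin d → ℝ)} (hU : IsOpen U) {x : Fin d → ℝ}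
    (hxU : x ∈ U) (hx : x ∈ coneFin y) : (U ∩ interior (coneFin y)).Nonempty := by
  have hcont : Continuous fun t : ℝ => x + t • ∑ i, (1 : ℝ) • toR (y i) := by fun_prop
  have hev : ∀ᶠ t in nhdsWithin (0 : ℝ) (Set.Ioi 0),
      x + t • ∑ i, (1 : ℝ) • toR (y i) ∈ U :=
    (hcont.continuousAt.eventually_mem (hU.mem_nhds (by simpa using hxU))).filter_mono
      nhdsWithin_le_nhds
  obtain ⟨t, htU, ht⟩ := (hev.and self_mem_nhdsWithin).exists
  refine ⟨_, htU, mem_interior_coneFin_of_repr_pos hy fun i => ?_⟩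
  rw [map_add, map_smul, Finsupp.add_apply, Finsupp.smul_apply, basisOfInt_repr_sum]
  have := (mem_coneFin_iff_repr_nonneg hy).mp hx i
  have ht' : 0 < t := ht
  simp only [smul_eq_mul, mul_one]
  linarith

/-- A lattice point of a simplicial cone lying in the group of the generators lies in their
monoid. -/
lemma mem_addSubmonoid_closure_of_mem_coneFin (hy : LinearIndependent ℝ (fun k => toR (y k)))
    {v : Fin d → ℤ} (hv : toR v ∈ coneFin y)
    (hvG : v ∈ AddSubgroup.closure (Set.range y)) :
    v ∈ AddSubmonoid.closure (Set.range y) := by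
  rw [← Submodule.span_int_eq_addSubgroupClosure, Submodule.mem_toAddSubgroup,
    Submodule.mem_span_range_iff_exists_fun] at hvG
  obtain ⟨c, rfl⟩ := hvG
  refine sum_mem fun i _ => ?_
  have hci := (mem_coneFin_iff_repr_nonneg hy).mp hv i
  simp_rw [toR_sum, toR_zsmul] at hci
  rw [basisOfInt_repr_sum hy (fun i => (c i : ℝ))] at hci
  obtain ⟨n, hn⟩ := Int.eq_ofNat_of_zero_le (Int.cast_nonneg_iff.mp hci)
  rw [hn, natCast_zsmul]
  exact nsmul_mem (AddSubmonoid.subset_closure (Set.mem_range_self i)) n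

/-- Every lattice point can be moved into the interior of a simplicial cone by a multiple of a
fixed lattice vector. -/
lemma exists_zsmul_add_mem_interior_coneFin (hy : LinearIndependent ℝ (fun k => toR (y k)))
    (x : Fin d → ℤ) {N : ℤ} (hN : 0 < N) :
    ∃ p : Fin d → ℤ, toR (x + N • p) ∈ interior (coneFin y) := by
  obtain ⟨k, hk⟩ := exists_nat_gt (∑ i, |(basisOfInt hy).repr (toR x) i|)
  refine ⟨∑ i, (k : ℤ) • y i, mem_interior_coneFin_of_repr_pos hy fun i => ?_⟩
  simp_rw [toR_add, toR_zsmul, toR_sum, toR_zsmul]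
  rw [map_add, map_smul, Finsupp.add_apply, Finsupp.smul_apply,
    basisOfInt_repr_sum hy (fun _ => ((k : ℤ) : ℝ))]
  have h1 : |(basisOfInt hy).repr (toR x) i| ≤ ∑ i, |(basisOfInt hy).repr (toR x) i| :=
    Finset.single_le_sum (f := fun i => |(basisOfInt hy).repr (toR x) i|)
      (fun _ _ => abs_nonneg _) (Finset.mem_univ i)
  have h2 := neg_abs_le ((basisOfInt hy).repr (toR x) i)
  have h3 : (1 : ℝ) ≤ N := by exact_mod_cast hN
  have h4 : (k : ℝ) ≤ N * k := le_mul_of_one_le_left (Nat.cast_nonneg k) h3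
  simp only [smul_eq_mul, Int.cast_natCast]
  linarith

end basisOfInt

lemma toR_mem_coneFin_of_mem_closure {d n : ℕ} {y : Fin n → Fin d → ℤ} {v : Fin d → ℤ}
    (hv : v ∈ AddSubmonoid.closure (Set.range y)) : toR v ∈ coneFin y := by
  classical
  induction hv using AddSubmonoid.closure_induction with
  | mem _ h =>
    obtain ⟨i, rfl⟩ := h
    exact ⟨Pi.single i 1, fun j => by by_cases h : j = i <;> simp [h],
      by simp [Pi.single_apply]⟩
  | zero => exact ⟨0, fun _ => le_rfl, by ext; simp⟩
  | add _ _ _ _ h₁ h₂ =>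
    obtain ⟨a, ha, h₁⟩ := h₁
    obtain ⟨b, hb, h₂⟩ := h₂
    exact ⟨a + b, fun i => add_nonneg (ha i) (hb i), by
      simp [toR_add, h₁, h₂, add_smul, Finset.sum_add_distrib]⟩

/-- A full-dimensional rational cone contains a simplicial one. -/
lemma IsRatCone.exists_coneFin_subset {d : ℕ} {D : Set (Fin d → ℝ)} (hD : IsRatCone D)
    (hDf : FullDim D) : ∃ u : Fin d → Fin d → ℤ,
      LinearIndependent ℝ (fun k => toR (u k)) ∧ coneFin u ⊆ D := by
  obtain ⟨B, rfl⟩ := hD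
  have hspan : Submodule.span ℝ (toR '' (B : Set (Fin d → ℤ))) = ⊤ := by
    rw [eq_top_iff, ← hDf, Submodule.span_le]
    rintro _ ⟨n, v, a, hv, -, rfl⟩
    exact sum_mem fun i _ => Submodule.smul_mem _ _ (Submodule.subset_span ⟨v i, hv i, rfl⟩)
  obtain ⟨f, hf, -, hli⟩ := Submodule.exists_fun_fin_finrank_span_eq ℝ
      (toR '' (B : Set (Fin d → ℤ)))
  have hr : Module.finrank ℝ (Submodule.span ℝ (toR '' (B : Set (Fin d → ℤ)))) = d := by
    rw [hspan]; simp
  choose g hgB hg using hf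
  refine ⟨fun k => g (Fin.cast hr.symm k), ?_, ?_⟩
  · simp_rw [hg]
    exact hli.comp _ (Fin.cast_injective hr.symm)
  · rintro _ ⟨a, ha, rfl⟩
    exact ⟨d, _, a, fun i => hgB _, ha, rfl⟩

/-- Lemma 3.1(c): let `D` be a `d`-dimensional subcone of `C` such that every
f-subcone `S` of `C` either contains `D` or has interior disjoint from the
interior of `D`. Let `G_D` be the intersection of the groups `Γ(S)` over the
f-subcones `S ⊇ D` and `H_D` their union. Then every lattice point of `D` lies
in `Σ(S)` for some f-subcone `S` iff every residue class of `ℤ^d` modulo `G_D`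
meets `H_D`. -/
theorem fcovered_iff_residue_classes {d : ℕ} (C D : Set (Fin d → ℝ))
    (hC : IsRatCone C) (hCp : PointedSet C) (hCf : FullDim C)
    (hD : IsRatCone D) (hDC : D ⊆ C) (hDf : FullDim D)
    (hsplit : ∀ y : Fin d → (Fin d → ℤ), IsFSubconeFam C y →
      D ⊆ coneFin y ∨ interior D ∩ interior (coneFin y) = ∅) :
    (∀ v : Fin d → ℤ, toR v ∈ D → ∃ y : Fin d → (Fin d → ℤ),
        IsFSubconeFam C y ∧ v ∈ AddSubmonoid.closure (Set.range y)) ↔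
    (∀ x : Fin d → ℤ, ∃ w : Fin d → ℤ,
        (w - x ∈ ⨅ (y : Fin d → (Fin d → ℤ))
          (_ : IsFSubconeFam C y ∧ D ⊆ coneFin y),
            AddSubgroup.closure (Set.range y)) ∧
        ∃ y : Fin d → (Fin d → ℤ), (IsFSubconeFam C y ∧ D ⊆ coneFin y) ∧
          w ∈ AddSubgroup.closure (Set.range y)) := by
  constructor
  · intro hcov x
    obtain ⟨N, hN, hNmem⟩ := hC.exists_pos_zsmul_mem
    obtain ⟨u, hu, huD⟩ := hD.exists_coneFin_subset hDf
    obtain ⟨p, hp⟩ := exists_zsmul_add_mem_interior_coneFin hu x hN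
    have hpD := interior_mono huD hp
    obtain ⟨y, hy, hmem⟩ := hcov _ (interior_subset hpD)
    have hmemG : x + N • p ∈ AddSubgroup.closure (Set.range y) :=
      AddSubgroup.le_closure_toAddSubmonoid (Set.range y) hmem
    have hcone : toR (x + N • p) ∈ coneFin y := toR_mem_coneFin_of_mem_closure hmem
    have hDy : D ⊆ coneFin y := (hsplit y hy).resolve_right
      (nonempty_inter_interior_coneFin hy.2 isOpen_interior hpD hcone).ne_empty
    refine ⟨x + N • p, ?_, y, ⟨hy, hDy⟩, hmemG⟩
    simp only [AddSubgroup.mem_iInf, add_sub_cancel_left]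
    exact fun z hz => hNmem z hz.1 p
  · intro hres v hv
    obtain ⟨w, hwG, y, ⟨hy, hDy⟩, hw⟩ := hres v
    simp only [AddSubgroup.mem_iInf] at hwG
    refine ⟨y, hy, mem_addSubmonoid_closure_of_mem_coneFin hy.2 (hDy hv) ?_⟩
    simpa using sub_mem hw (hwG y ⟨hy, hDy⟩)
end

section
/- Let $M\subseteq\mathbb{Z}^d$ be a positive affine monoid with $\operatorname{gp}(M)=\mathbb{Z}^d$. If $M$ satisfies the integral Carathéodory property (ICP), then $M=\mathbb{R}_+M\cap\mathbb{Z}^d$, i.e., every lattice point of the cone $\mathbb{R}_+M$ generated by $M$ already belongs to $M$. -/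
/-- The Hilbert basis of a positive affine monoid `M`: the nonzero elements of
`M` admitting no decomposition into a sum of two nonzero elements of `M`. -/
def hilbM {d : ℕ} (M : AddSubmonoid (Fin d → ℤ)) : Set (Fin d → ℤ) :=
  { z | z ∈ M ∧ z ≠ 0 ∧ ¬∃ u v : Fin d → ℤ, u ∈ M ∧ v ∈ M ∧ u ≠ 0 ∧ v ≠ 0 ∧ z = u + v }

/-- `M` satisfies the integral Carathéodory property: every element of `M` is a
nonnegative integral combination of at most `d` elements of `Hilb(M)`. -/
def ICPmonoid {d : ℕ} (M : AddSubmonoid (Fin d → ℤ)) : Prop :=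
  ∀ x ∈ M, ∃ (s : Finset (Fin d → ℤ)) (a : (Fin d → ℤ) → ℕ),
    (s : Set (Fin d → ℤ)) ⊆ hilbM M ∧ s.card ≤ d ∧ x = ∑ y ∈ s, a y • y

open Filter Topology

/-- The elements of `G` having a positive multiple in `H`. -/
def isolator {G : Type*} [AddCommGroup G] (H : AddSubgroup G) : AddSubgroup G where
  carrier := { z | ∃ n : ℕ, 0 < n ∧ n • z ∈ H }
  zero_mem' := ⟨1, one_pos, by simp⟩
  add_mem' := by
    rintro x y ⟨m, hm, hx⟩ ⟨n, hn, hy⟩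
    refine ⟨m * n, Nat.mul_pos hm hn, ?_⟩
    have h1 : (m * n) • (x + y) = n • (m • x) + m • (n • y) := by
      rw [smul_add, smul_smul, smul_smul, mul_comm n m]
    rw [h1]
    exact H.add_mem (H.nsmul_mem hx n) (H.nsmul_mem hy m)
  neg_mem' := by
    rintro x ⟨m, hm, hx⟩
    exact ⟨m, hm, by rw [smul_neg]; exact H.neg_mem hx⟩

theorem le_isolator {G : Type*} [AddCommGroup G] (H : AddSubgroup G) : H ≤ isolator H :=
  fun x hx => ⟨1, one_pos, by simpa using hx⟩

theorem mem_isolator_of_zsmul_mem {G : Type*} [AddCommGroup G] (H : AddSubgroup G) (n : ℤ)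
    (hn : n ≠ 0) (z : G) (h : n • z ∈ isolator H) : z ∈ isolator H := by
  obtain ⟨m, hm, hz⟩ := h
  refine ⟨m * n.natAbs, Nat.mul_pos hm (Int.natAbs_pos.mpr hn), ?_⟩
  rw [mul_smul]
  rcases Int.natAbs_eq n with h' | h'
  · rw [h', natCast_zsmul] at hz
    exact hz
  · rw [h', neg_smul, natCast_zsmul, smul_neg] at hz
    simpa using H.neg_mem hz

theorem eventually_not_of_pairwise {P : ℕ → Prop}
    (h : ∀ m n, 2 ≤ m → m < n → P m → ¬ P n) : ∀ᶠ n in atTop, ¬ P n := by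
  by_cases hP : ∃ m, 2 ≤ m ∧ P m
  · obtain ⟨m, hm, hPm⟩ := hP
    filter_upwards [eventually_gt_atTop m] with n hn using h m n hm hn hPm
  · push Not at hP
    filter_upwards [eventually_ge_atTop 2] with n hn using hP n hn

theorem eventually_add_nsmul_notMem {G : Type*} [AddCommGroup G] (H : AddSubgroup G)
    (hsat : ∀ n : ℤ, n ≠ 0 → ∀ z, n • z ∈ H → z ∈ H) {x u : G} (h : x ∉ H ∨ u ∉ H) :
    ∀ᶠ k : ℕ in atTop, x + k • u ∉ H := by
  apply eventually_not_of_pairwise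
  intro m n _ hmn hm hn
  have hu : u ∈ H := by
    apply hsat ((n : ℤ) - m) (by omega)
    have := H.sub_mem hn hm
    rw [add_sub_add_left_eq_sub] at this
    simpa [sub_smul] using this
  have hx : x ∈ H := by
    have := H.sub_mem hm (H.nsmul_mem hu m)
    simpa using this
  tauto

theorem exists_mem_forall_notMem {G : Type*} [AddCommGroup G] (M : AddSubmonoid G)
    (hgp : AddSubgroup.closure (M : Set G) = ⊤) (F : Finset (AddSubgroup G))
    (hsat : ∀ H ∈ F, ∀ n : ℤ, n ≠ 0 → ∀ z, n • z ∈ H → z ∈ H) (hne : ∀ H ∈ F, H ≠ ⊤) :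
    ∃ w ∈ M, ∀ H ∈ F, w ∉ H := by
  classical
  induction F using Finset.induction_on with
  | empty => exact ⟨0, M.zero_mem, by simp⟩
  | insert H F _ ih =>
    obtain ⟨w, hw, hwF⟩ := ih (fun H h => hsat H (Finset.mem_insert_of_mem h))
      (fun H h => hne H (Finset.mem_insert_of_mem h))
    obtain ⟨u, hu, huH⟩ : ∃ u ∈ M, u ∉ H := by
      by_contra! hcon
      apply hne H (Finset.mem_insert_self _ _)
      rw [eq_top_iff, ← hgp, AddSubgroup.closure_le]
      exact hcon
    have hev : ∀ᶠ k : ℕ in atTop, ∀ K ∈ insert H F, w + k • u ∉ K := by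
      rw [eventually_all_finset]
      intro K hK
      apply eventually_add_nsmul_notMem K (hsat K hK)
      rcases Finset.mem_insert.mp hK with rfl | hK
      · exact Or.inr huH
      · exact Or.inl (hwF K hK)
    obtain ⟨k, hk⟩ := hev.exists
    exact ⟨w + k • u, M.add_mem hw (M.nsmul_mem hu k), hk⟩

/-- Finitely many positive reals can be kept positive by a rational functional. -/
theorem exists_linearMap_rat_pos (s : Finset ℝ) (hs : ∀ x ∈ s, 0 < x) :
    ∃ φ : ℝ →ₗ[ℚ] ℚ, ∀ x ∈ s, 0 < φ x := by
  let W : Submodule ℚ ℝ := Submodule.span ℚ (s : Set ℝ)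
  have : FiniteDimensional ℚ W := FiniteDimensional.span_finset ℚ s
  let b := Module.finBasis ℚ W
  let t : Fin (Module.finrank ℚ W) → ℝ := fun j => (b j : ℝ)
  have hexp : ∀ x : W, (x : ℝ) = ∑ j, (b.repr x j : ℝ) * t j := by
    intro x
    conv_lhs => rw [← b.sum_repr x]
    simp only [t, AddSubmonoidClass.coe_finsetSum, SetLike.val_smul, Rat.smul_def]
  have hopen : IsOpen { R : Fin (Module.finrank ℚ W) → ℝ |
      ∀ x : s, 0 < ∑ j, (b.repr ⟨x, Submodule.subset_span x.2⟩ j : ℝ) * R j } := by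
    rw [Set.ofPred_forall]
    exact isOpen_iInter_of_finite fun x => isOpen_lt continuous_const (by fun_prop)
  have hdense : DenseRange (Pi.map fun _ : Fin (Module.finrank ℚ W) => ((↑) : ℚ → ℝ)) :=
    DenseRange.piMap fun _ => Rat.denseRange_cast
  obtain ⟨r, hr⟩ := hdense.exists_mem_open hopen
    ⟨t, fun x => by rw [← hexp]; exact hs x x.2⟩
  let φ₀ : W →ₗ[ℚ] ℚ := b.constr ℚ r
  obtain ⟨φ, hφ⟩ := φ₀.exists_extend
  refine ⟨φ, fun x hx => ?_⟩
  have h1 : φ x = φ₀ ⟨x, Submodule.subset_span hx⟩ := by rw [← hφ]; rfl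
  have h2 := hr ⟨x, hx⟩
  rw [h1]
  simp only [φ₀, Module.Basis.constr_apply_fintype, Module.Basis.equivFun_apply, smul_eq_mul]
  simp only [Pi.map_apply] at h2
  exact_mod_cast h2

theorem exists_natCast_eq_mul {ι : Type*} [Fintype ι] (q : ι → ℚ) (hq : ∀ i, 0 ≤ q i) :
    ∃ D : ℕ, 0 < D ∧ ∀ i, ∃ p : ℕ, (p : ℚ) = D * q i := by
  classical
  refine ⟨∏ i, (q i).den, Finset.prod_pos fun i _ => (q i).den_pos, fun i => ?_⟩
  refine ⟨(∏ j ∈ Finset.univ.erase i, (q j).den) * (q i).num.toNat, ?_⟩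
  rw [← Finset.mul_prod_erase Finset.univ (fun i => (q i).den) (Finset.mem_univ i)]
  have h1 : (((q i).num.toNat : ℕ) : ℚ) = (q i).num := by
    exact_mod_cast Int.toNat_of_nonneg (Rat.num_nonneg.mpr (hq i))
  have h2 : ((q i).den : ℚ) * q i = (q i).num := Rat.den_mul_eq_num (q i)
  push_cast
  rw [h1, ← h2]
  ring

theorem exists_nsmul_mem_of_toR_mem_coneSet {d : ℕ} (M : AddSubmonoid (Fin d → ℤ))
    {v : Fin d → ℤ} (hv : toR v ∈ coneSet (M : Set (Fin d → ℤ))) :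
    ∃ k : ℕ, 0 < k ∧ k • v ∈ M := by
  classical
  obtain ⟨n, x, a, hx, ha, hsum⟩ := hv
  obtain ⟨φ, hφ⟩ := exists_linearMap_rat_pos
    ((insert 1 (Finset.univ.image a)).filter (0 < ·)) (fun x hx => (Finset.mem_filter.mp hx).2)
  have hφ1 : 0 < φ 1 := hφ 1 (by simp)
  have hφa : ∀ i, 0 ≤ φ (a i) := by
    intro i
    rcases (ha i).eq_or_lt with h | h
    · rw [← h, map_zero]
    · exact (hφ _ (by simp [h])).le
  have hmul : ∀ (r : ℝ) (z : ℤ), φ (r * z) = φ r * z := by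
    intro r z
    have : r * z = z • r := by rw [zsmul_eq_mul, mul_comm]
    rw [this, map_zsmul, zsmul_eq_mul, mul_comm]
  obtain ⟨D, hD, hp⟩ := exists_natCast_eq_mul (fun o : Option (Fin n) => o.elim (φ 1) (φ ∘ a))
    (by rintro (_ | i); exacts [hφ1.le, hφa i])
  choose p hp using hp
  have hp0 : (p none : ℚ) = D * φ 1 := hp none
  have hpi : ∀ i, (p (some i) : ℚ) = D * φ (a i) := fun i => hp (some i)
  refine ⟨p none, ?_, ?_⟩
  · have : (0 : ℚ) < p none := by rw [hp0]; positivity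
    exact_mod_cast this
  · have hv : p none • v = ∑ i, p (some i) • x i := by
      ext j
      have h1 := congrArg φ (congrFun hsum j)
      simp only [toR, Finset.sum_apply, Pi.smul_apply, smul_eq_mul, map_sum, hmul] at h1
      rw [← one_mul (v j : ℝ), hmul] at h1
      have h2 : ((p none : ℚ)) * v j = ∑ i, (p (some i) : ℚ) * x i j := by
        simp only [hp0, hpi, mul_assoc, h1, Finset.mul_sum]
      simp only [Pi.smul_apply, Finset.sum_apply, nsmul_eq_mul]
      exact_mod_cast h2
    rw [hv]
    exact M.sum_mem fun i _ => M.nsmul_mem (hx i) _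

theorem finite_hilbM {d : ℕ} (M : AddSubmonoid (Fin d → ℤ)) (hFG : M.FG) :
    (hilbM M).Finite := by
  obtain ⟨S, hS⟩ := hFG
  refine S.finite_toSet.subset fun z hz => ?_
  have hzM : z ∈ AddSubmonoid.closure (S : Set (Fin d → ℤ)) := hS ▸ hz.1
  induction hzM using AddSubmonoid.closure_induction with
  | mem x hx => exact hx
  | zero => exact absurd rfl hz.2.1
  | add x y hx hy ihx ihy =>
    rw [hS] at hx hy
    by_cases hx0 : x = 0
    · rw [hx0, zero_add] at hz ⊢
      exact ihy hz
    by_cases hy0 : y = 0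
    · rw [hy0, add_zero] at hz ⊢
      exact ihx hz
    exact absurd ⟨x, y, hx, hy, hx0, hy0, rfl⟩ hz.2.2

theorem exists_nsmul_mem_of_isolator_eq_top {d : ℕ} (H : AddSubgroup (Fin d → ℤ))
    (hH : isolator H = ⊤) : ∃ n : ℕ, 0 < n ∧ ∀ z, n • z ∈ H := by
  have h : ∀ i : Fin d, ∃ n : ℕ, 0 < n ∧ n • (Pi.single i (1 : ℤ) : Fin d → ℤ) ∈ H := fun i => by
    have : (Pi.single i (1 : ℤ) : Fin d → ℤ) ∈ isolator H := hH ▸ AddSubgroup.mem_top _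
    exact this
  choose n hn hmem using h
  refine ⟨∏ i, n i, Finset.prod_pos fun i _ => hn i, fun z => ?_⟩
  have hz : z = ∑ i, z i • (Pi.single i (1 : ℤ) : Fin d → ℤ) := pi_eq_sum_univ' z
  rw [hz, Finset.smul_sum]
  refine H.sum_mem fun i _ => ?_
  rw [smul_comm]
  refine H.zsmul_mem ?_ _
  rw [← Finset.prod_erase_mul _ _ (Finset.mem_univ i), mul_smul]
  exact H.nsmul_mem (hmem i) _

theorem linearIndependent_of_forall_nsmul_mem {d : ℕ} (s : Finset (Fin d → ℤ))
    (hcard : s.card ≤ d) {N : ℕ} (hN : 0 < N)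
    (h : ∀ z, N • z ∈ AddSubgroup.closure (s : Set (Fin d → ℤ))) :
    LinearIndependent ℤ (fun y : s => (y : Fin d → ℤ)) := by
  let ι : (Fin d → ℤ) →+ (Fin d → ℚ) := (Int.castAddHom ℚ).compLeft (Fin d)
  have hmem : ∀ z ∈ AddSubgroup.closure (s : Set (Fin d → ℤ)),
      ι z ∈ Submodule.span ℚ (Set.range fun y : s => ι y) := by
    intro z hz
    induction hz using AddSubgroup.closure_induction with
    | mem x hx => exact Submodule.subset_span ⟨⟨x, hx⟩, rfl⟩
    | zero => simp
    | add x y _ _ hx hy => rw [map_add]; exact Submodule.add_mem _ hx hy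
    | neg x _ hx => rw [map_neg]; exact Submodule.neg_mem _ hx
  have htop : ⊤ ≤ Submodule.span ℚ (Set.range fun y : s => ι y) := by
    rintro q -
    rw [pi_eq_sum_univ' q]
    refine Submodule.sum_mem _ fun i _ => Submodule.smul_mem _ _ ?_
    have h1 := hmem _ (h (Pi.single i 1))
    have h2 : ι (N • Pi.single i 1) = (N : ℚ) • (Pi.single i 1 : Fin d → ℚ) := by
      ext j
      by_cases hij : i = j
      · subst hij; simp [ι]
      · simp [ι, Ne.symm hij]
    rw [h2] at h1
    have hN' : (N : ℚ) ≠ 0 := by exact_mod_cast hN.ne'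
    simpa [smul_smul, inv_mul_cancel₀ hN'] using Submodule.smul_mem _ (N : ℚ)⁻¹ h1
  have hrank : Module.finrank ℚ (Fin d → ℚ) = d := by simp
  have hle : d ≤ Fintype.card s := by
    have h1 := finrank_range_le_card (R := ℚ) (fun y : s => ι y)
    rw [Set.finrank, top_le_iff.mp htop, finrank_top, hrank] at h1
    exact h1
  have hli : LinearIndependent ℚ (fun y : s => ι y) :=
    linearIndependent_of_top_le_span_of_card_eq_finrank htop
      (by rw [hrank]; exact le_antisymm (by simpa using hcard) hle)
  exact LinearIndependent.of_comp ι.toIntLinearMap (hli.restrict_scalars' ℤ)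

theorem nonneg_of_eventually_quadratic (N b c : ℤ) (hN : 0 < N) :
    ∀ᶠ n : ℕ in atTop, 0 ≤ (1 + N * n ^ 2) * b + n * c → 0 ≤ b := by
  filter_upwards [eventually_ge_atTop c.natAbs] with n hn h
  by_contra! hb
  have hn' : c ≤ n := by omega
  have h0 : (0 : ℤ) ≤ n := by positivity
  nlinarith [mul_nonneg h0 (sub_nonneg.mpr hn'), sq_nonneg (n : ℤ),
    mul_nonneg (sub_nonneg.mpr (show (1 : ℤ) ≤ N from hN)) (sq_nonneg (n : ℤ)),
    mul_nonneg (show 0 ≤ 1 + N * (n : ℤ) ^ 2 by positivity) (show (0 : ℤ) ≤ -1 - b by omega)]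

theorem exists_sum_zsmul_of_mem_closure {G : Type*} [AddCommGroup G] (s : Finset G) {z : G}
    (hz : z ∈ AddSubgroup.closure (s : Set G)) : ∃ b : G → ℤ, z = ∑ y ∈ s, b y • y := by
  have h1 : z ∈ Submodule.span ℤ (s : Set G) := by
    rw [← Submodule.mem_toAddSubgroup, Submodule.span_int_eq_addSubgroupClosure]
    exact hz
  obtain ⟨b, -, hb⟩ := Submodule.mem_span_finset.mp h1
  exact ⟨b, hb.symm⟩

theorem eventually_mem_of_full {d : ℕ} (M : AddSubmonoid (Fin d → ℤ)) (s : Finset (Fin d → ℤ))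
    (hsM : ∀ y ∈ s, y ∈ M) (hcard : s.card ≤ d) {N : ℕ} (hN : 0 < N)
    (h : ∀ z, N • z ∈ AddSubgroup.closure (s : Set (Fin d → ℤ))) (v w : Fin d → ℤ) :
    ∀ᶠ n : ℕ in atTop, ∀ a : (Fin d → ℤ) → ℕ,
      v + N • (n ^ 2 • v + n • w) = ∑ y ∈ s, a y • y → v ∈ M := by
  by_cases hv : v ∈ AddSubgroup.closure (s : Set (Fin d → ℤ))
  · obtain ⟨b, hb⟩ := exists_sum_zsmul_of_mem_closure s hv
    obtain ⟨c, hc⟩ := exists_sum_zsmul_of_mem_closure s (h w)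
    have hev : ∀ᶠ n : ℕ in atTop, ∀ y ∈ s,
        0 ≤ (1 + (N : ℤ) * n ^ 2) * b y + n * c y → 0 ≤ b y := by
      rw [eventually_all_finset]
      exact fun y _ => nonneg_of_eventually_quadratic N (b y) (c y) (by exact_mod_cast hN)
    filter_upwards [hev] with n hn a ha
    have hli := linearIndependent_of_forall_nsmul_mem s hcard hN h
    have hcomb : ∑ y ∈ s, ((1 + (N : ℤ) * n ^ 2) * b y + n * c y - a y) • y = 0 := by
      have h1 : v + N • (n ^ 2 • v + n • w) = (1 + (N : ℤ) * n ^ 2) • v + (n : ℤ) • (N • w) := by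
        module
      rw [h1] at ha
      simp only [sub_smul, add_smul (_ * _) (_ * _), mul_smul, Finset.sum_sub_distrib,
        Finset.sum_add_distrib, ← Finset.smul_sum, ← hb, ← hc, natCast_zsmul]
      simp only [natCast_zsmul] at ha
      rw [← ha, sub_self]
    have hcoef : ∀ y ∈ s, (1 + (N : ℤ) * n ^ 2) * b y + n * c y - a y = 0 := by
      intro y hy
      rw [← Finset.sum_coe_sort] at hcomb
      exact Fintype.linearIndependent_iff.mp hli
        (fun y => (1 + (N : ℤ) * n ^ 2) * b y + n * c y - a y) hcomb ⟨y, hy⟩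
    rw [hb]
    refine M.sum_mem fun y hy => ?_
    have hby : 0 ≤ b y := hn y hy (by rw [sub_eq_zero.mp (hcoef y hy)]; positivity)
    rw [← Int.toNat_of_nonneg hby, natCast_zsmul]
    exact M.nsmul_mem (hsM y hy) _
  · refine Eventually.of_forall fun n a ha => absurd ?_ hv
    have h1 : v = ∑ y ∈ s, a y • y - N • (n ^ 2 • v + n • w) := by rw [← ha]; abel
    rw [h1]
    exact AddSubgroup.sub_mem _ (AddSubgroup.sum_mem _ fun y hy =>
      AddSubgroup.nsmul_mem _ (AddSubgroup.subset_closure hy) _) (h _)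

theorem eventually_notMem_of_quadratic {G : Type*} [AddCommGroup G] (H : AddSubgroup G)
    (hsat : ∀ n : ℤ, n ≠ 0 → ∀ z, n • z ∈ H → z ∈ H) {N : ℕ} (hN : 0 < N) (v : G) {w : G}
    (hw : w ∉ H) : ∀ᶠ n : ℕ in atTop, v + N • (n ^ 2 • v + n • w) ∉ H := by
  apply eventually_not_of_pairwise
  intro m n hm hmn h1 h2
  apply hw
  apply hsat ((N : ℤ) * ((n - m) * (1 - N * n * m)))
  · have h3 : 1 < N * n * m :=
      lt_of_lt_of_le hm (Nat.le_mul_of_pos_left m (Nat.mul_pos hN (by omega)))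
    have h3' : (1 : ℤ) < N * n * m := by exact_mod_cast h3
    have hN' : (N : ℤ) ≠ 0 := by omega
    exact mul_ne_zero hN' (mul_ne_zero (by omega) (by omega))
  · have h4 := H.sub_mem (H.zsmul_mem h2 (1 + N * m ^ 2)) (H.zsmul_mem h1 (1 + N * n ^ 2))
    convert h4 using 1
    module

theorem add_nsmul_mem_of_nsmul_mem {G : Type*} [AddCommGroup G] (M : AddSubmonoid G) {a b : G}
    (ha : a ∈ M) (hb : b ∈ M) {k : ℕ} (hk : 0 < k) (hkv : k • (a - b) ∈ M) (n : ℕ) :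
    n • (a - b) + k • b ∈ M := by
  have hq : n % k ≤ k := (Nat.mod_lt n hk).le
  have h1 : n • (a - b) + k • b =
      (n / k) • (k • (a - b)) + ((n % k) • a + (k - n % k) • b) := by
    conv_lhs => rw [← Nat.div_add_mod n k]
    obtain ⟨r, hr⟩ := Nat.exists_eq_add_of_le hq
    have h2 : k - n % k = r := by omega
    have h3 : k • b = (n % k) • b + r • b := by rw [← add_smul, ← hr]
    rw [h2, h3, add_smul, mul_comm k, mul_smul, smul_sub (n % k)]
    abel
  rw [h1]
  exact M.add_mem (M.nsmul_mem hkv _) (M.add_mem (M.nsmul_mem ha _) (M.nsmul_mem hb _))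

theorem exists_sub_of_closure_eq_top {G : Type*} [AddCommGroup G] (M : AddSubmonoid G)
    (hgp : AddSubgroup.closure (M : Set G) = ⊤) (v : G) : ∃ a ∈ M, ∃ b ∈ M, v = a - b := by
  have hv : v ∈ AddSubgroup.closure (M : Set G) := hgp ▸ AddSubgroup.mem_top v
  induction hv using AddSubgroup.closure_induction with
  | mem x hx => exact ⟨x, hx, 0, M.zero_mem, by simp⟩
  | zero => exact ⟨0, M.zero_mem, 0, M.zero_mem, by simp⟩
  | add x y _ _ hx hy =>
    obtain ⟨a, ha, b, hb, rfl⟩ := hx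
    obtain ⟨a', ha', b', hb', rfl⟩ := hy
    exact ⟨a + a', M.add_mem ha ha', b + b', M.add_mem hb hb', by abel⟩
  | neg x _ hx =>
    obtain ⟨a, ha, b, hb, rfl⟩ := hx
    exact ⟨b, hb, a, ha, by abel⟩

theorem mem_of_nsmul_mem_of_ICP {d : ℕ} (M : AddSubmonoid (Fin d → ℤ)) (hFG : M.FG)
    (hgp : AddSubgroup.closure (M : Set (Fin d → ℤ)) = ⊤) (hICP : ICPmonoid M)
    {v : Fin d → ℤ} {k : ℕ} (hk : 0 < k) (hkv : k • v ∈ M) : v ∈ M := by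
  classical
  let 𝒳 : Finset (Finset (Fin d → ℤ)) := (finite_hilbM M hFG).toFinset.powerset
  let L : Finset (Fin d → ℤ) → AddSubgroup (Fin d → ℤ) := fun s =>
    AddSubgroup.closure (s : Set (Fin d → ℤ))
  have hfull : ∀ s : Finset (Fin d → ℤ), ∃ n : ℕ, 0 < n ∧
      (isolator (L s) = ⊤ → ∀ z, n • z ∈ L s) := by
    intro s
    by_cases hs : isolator (L s) = ⊤
    · obtain ⟨n, hn, h⟩ := exists_nsmul_mem_of_isolator_eq_top _ hs
      exact ⟨n, hn, fun _ => h⟩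
    · exact ⟨1, one_pos, fun h => absurd h hs⟩
  choose m hm hmL using hfull
  obtain ⟨N, hN, hNL⟩ : ∃ N : ℕ, 0 < N ∧
      ∀ s ∈ 𝒳, isolator (L s) = ⊤ → ∀ z, N • z ∈ L s := by
    refine ⟨∏ s ∈ 𝒳, m s, Finset.prod_pos fun s _ => hm s, fun s hs hst z => ?_⟩
    rw [← Finset.prod_erase_mul _ _ hs, mul_smul]
    exact (L s).nsmul_mem (hmL s hst z) _
  let F : Finset (AddSubgroup (Fin d → ℤ)) :=
    (𝒳.image fun s => isolator (L s)).filter (· ≠ ⊤)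
  have hFsat : ∀ H ∈ F, ∀ n : ℤ, n ≠ 0 → ∀ z, n • z ∈ H → z ∈ H := by
    intro H hH
    obtain ⟨s, -, rfl⟩ := Finset.mem_image.mp (Finset.mem_filter.mp hH).1
    exact mem_isolator_of_zsmul_mem _
  obtain ⟨u, hu, huF⟩ := exists_mem_forall_notMem M hgp F hFsat
    fun H hH => (Finset.mem_filter.mp hH).2
  obtain ⟨a, ha, b, hb, rfl⟩ := exists_sub_of_closure_eq_top M hgp v
  have hev : ∀ᶠ j : ℕ in atTop, ∀ H ∈ F, k • b + j • u ∉ H := by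
    rw [eventually_all_finset]
    exact fun H hH => eventually_add_nsmul_notMem H (hFsat H hH) (Or.inr (huF H hH))
  obtain ⟨j, hj⟩ := hev.exists
  set w := k • b + j • u with hw
  have hwM : w ∈ M := M.add_mem (M.nsmul_mem hb _) (M.nsmul_mem hu _)
  have hmem : ∀ n : ℕ, 0 < n → a - b + N • (n ^ 2 • (a - b) + n • w) ∈ M := by
    intro n hn
    obtain ⟨r, hr⟩ : ∃ r, N * n = r + 1 := Nat.exists_eq_add_of_le' (Nat.mul_pos hN hn)
    have h1 : a - b + N • (n ^ 2 • (a - b) + n • w) =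
        ((1 + N * n ^ 2) • (a - b) + k • b) + (j • u + r • w) := by
      have h2 : N • n • w = r • w + w := by rw [smul_smul, hr, add_smul, one_smul]
      rw [smul_add, h2, add_smul, one_smul, mul_smul]
      nth_rewrite 2 [hw]
      abel
    rw [h1]
    exact M.add_mem (add_nsmul_mem_of_nsmul_mem M ha hb hk hkv _)
      (M.add_mem (M.nsmul_mem hu _) (M.nsmul_mem hwM _))
  have hgood : ∀ᶠ n : ℕ in atTop, ∀ s ∈ 𝒳, s.card ≤ d → ∀ e : (Fin d → ℤ) → ℕ,
      a - b + N • (n ^ 2 • (a - b) + n • w) = ∑ y ∈ s, e y • y → a - b ∈ M := by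
    rw [eventually_all_finset]
    intro s hs
    by_cases hst : isolator (L s) = ⊤
    · by_cases hcard : s.card ≤ d
      · have hsM : ∀ y ∈ s, y ∈ M := fun y hy =>
          ((finite_hilbM M hFG).mem_toFinset.mp (Finset.mem_powerset.mp hs hy)).1
        filter_upwards [eventually_mem_of_full M s hsM hcard hN (hNL s hs hst) (a - b) w] with n hn _
          using hn
      · exact Eventually.of_forall fun n h => absurd h hcard
    · have hsF : isolator (L s) ∈ F :=
        Finset.mem_filter.mpr ⟨Finset.mem_image_of_mem _ hs, hst⟩
      filter_upwards [eventually_notMem_of_quadratic _ (hFsat _ hsF) hN (a - b) (hj _ hsF)]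
        with n hn _ e he
      refine absurd ?_ hn
      rw [he]
      exact le_isolator _ (AddSubgroup.sum_mem _ fun y hy =>
        AddSubgroup.nsmul_mem _ (AddSubgroup.subset_closure hy) _)
  obtain ⟨n, hn, hn0⟩ := (hgood.and (eventually_gt_atTop 0)).exists
  obtain ⟨s, e, hs, hcard, he⟩ := hICP _ (hmem n hn0)
  refine hn s (Finset.mem_powerset.mpr fun y hy => ?_) hcard e he
  exact (finite_hilbM M hFG).mem_toFinset.mpr (hs hy)

/-- Theorem 3.2, first part: a positive affine monoid `M ⊆ ℤ^d` with
`gp(M) = ℤ^d` satisfying (ICP) is integrally closed: `M = ℝ₊M ∩ ℤ^d`. -/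
theorem eq_lattice_points_of_ICP {d : ℕ} (M : AddSubmonoid (Fin d → ℤ))
    (hFG : M.FG) (hpos : ∀ x ∈ M, -x ∈ M → x = 0)
    (hgp : AddSubgroup.closure (M : Set (Fin d → ℤ)) = ⊤)
    (hICP : ICPmonoid M) :
    ∀ v : Fin d → ℤ, toR v ∈ coneSet (M : Set (Fin d → ℤ)) ↔ v ∈ M := by
  intro v
  constructor
  · intro hv
    obtain ⟨k, hk, hkv⟩ := exists_nsmul_mem_of_toR_mem_coneSet M hv
    exact mem_of_nsmul_mem_of_ICP M hFG hgp hICP hk hkv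
  · intro hv
    exact ⟨1, fun _ => v, fun _ => 1, fun _ => hv, fun _ => zero_le_one, by simp⟩
end

section
/- Let $M\subseteq\mathbb{Z}^d$ be a positive affine monoid with $\operatorname{gp}(M)=\mathbb{Z}^d$. If $M$ satisfies the integral Carathéodory property (ICP), then every element of $M$ is $f$-covered: for every $x\in M$ there exist $d$ linearly independent elements $y_1,\dots,y_d\in\operatorname{Hilb}(M)$ and nonnegative integers $a_1,\dots,a_d$ with $x=a_1y_1+\dots+a_dy_d$. -/
open Matrix in
theorem exists_mem_dotProduct_ne_zero {d : ℕ} {M : AddSubmonoid (Fin d → ℤ)}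
    (hgp : AddSubgroup.closure (M : Set (Fin d → ℤ)) = ⊤) {w : Fin d → ℤ} (hw : w ≠ 0) :
    ∃ u ∈ M, w ⬝ᵥ u ≠ 0 := by
  by_contra! h
  refine hw (dotProduct_eq_zero w fun v => ?_)
  have hv : v ∈ AddSubgroup.closure (M : Set (Fin d → ℤ)) := hgp ▸ AddSubgroup.mem_top v
  induction hv using AddSubgroup.closure_induction with
  | mem u hu => exact h u hu
  | zero => exact dotProduct_zero w
  | add u v _ _ hu hv => rw [dotProduct_add, hu, hv, add_zero]
  | neg u _ hu => rw [dotProduct_neg, hu, neg_zero]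

open Matrix in
/-- A submonoid generating `ℤ^d` is not contained in a finite union of hyperplanes. -/
theorem exists_mem_forall_dotProduct_ne_zero {d : ℕ} {M : AddSubmonoid (Fin d → ℤ)}
    (hgp : AddSubgroup.closure (M : Set (Fin d → ℤ)) = ⊤) (F : Finset (Fin d → ℤ))
    (hF : ∀ w ∈ F, w ≠ 0) : ∃ z ∈ M, ∀ w ∈ F, w ⬝ᵥ z ≠ 0 := by
  induction F using Finset.induction_on with
  | empty => exact ⟨0, M.zero_mem, by simp⟩
  | insert w F _ ih =>
    obtain ⟨z, hz, hzF⟩ := ih fun v hv => hF v (Finset.mem_insert_of_mem hv)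
    by_cases hwz : w ⬝ᵥ z = 0
    · obtain ⟨u, hu, hwu⟩ :=
        exists_mem_dotProduct_ne_zero hgp (hF w (Finset.mem_insert_self w F))
      set N : ℕ := (∑ v ∈ F, (v ⬝ᵥ u).natAbs) + 1
      refine ⟨N • z + u, M.add_mem (M.nsmul_mem hz N) hu, fun v hv => ?_⟩
      rw [dotProduct_add, dotProduct_smul, nsmul_eq_mul]
      obtain rfl | hv := Finset.mem_insert.1 hv
      · simpa [hwz] using hwu
      · intro h0
        have hle : (v ⬝ᵥ u).natAbs ≤ ∑ v ∈ F, (v ⬝ᵥ u).natAbs :=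
          Finset.single_le_sum (f := fun v => (v ⬝ᵥ u).natAbs) (fun _ _ => Nat.zero_le _) hv
        have heq : (v ⬝ᵥ u).natAbs = N * (v ⬝ᵥ z).natAbs := by
          rw [eq_neg_of_add_eq_zero_right h0, Int.natAbs_neg, Int.natAbs_mul, Int.natAbs_natCast]
        have hpos : 1 ≤ (v ⬝ᵥ z).natAbs := Int.natAbs_pos.2 (hzF v hv)
        have : N ≤ N * (v ⬝ᵥ z).natAbs := Nat.le_mul_of_pos_right N hpos
        omega
    · refine ⟨z, hz, fun v hv => ?_⟩
      obtain rfl | hv := Finset.mem_insert.1 hv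
      exacts [hwz, hzF v hv]

theorem hilbM_finite {d : ℕ} {M : AddSubmonoid (Fin d → ℤ)} (hFG : M.FG) :
    (hilbM M).Finite := by
  obtain ⟨S, rfl⟩ := hFG
  refine S.finite_toSet.subset fun z hz => ?_
  have hzS := hz.1
  induction hzS using AddSubmonoid.closure_induction with
  | mem u hu => exact hu
  | zero => exact absurd rfl hz.2.1
  | add u v hu hv ihu ihv =>
    by_cases hu0 : u = 0
    · subst hu0
      rw [zero_add] at hz ⊢
      exact ihv hz
    by_cases hv0 : v = 0
    · subst hv0
      rw [add_zero] at hz ⊢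
      exact ihu hz
    exact absurd ⟨u, v, hu, hv, hu0, hv0, rfl⟩ hz.2.2

open Matrix in
/-- Under (ICP) every element is a combination of a family of exactly `d` vectors, once short
families are padded with zeros. -/
theorem ICPmonoid.exists_vecMul {d : ℕ} {M : AddSubmonoid (Fin d → ℤ)} (hICP : ICPmonoid M)
    {x : Fin d → ℤ} (hx : x ∈ M) :
    ∃ y : Fin d → (insert 0 (hilbM M) : Set (Fin d → ℤ)), ∃ a : Fin d → ℕ,
      x = (fun k => (a k : ℤ)) ᵥ* Matrix.of fun k => (y k : Fin d → ℤ) := by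
  obtain ⟨s, a, hs, hcard, rfl⟩ := hICP x hx
  obtain ⟨f⟩ : Nonempty (s ↪ Fin d) := Function.Embedding.nonempty_of_card_le (by simpa)
  refine ⟨Function.extend f (fun v => ⟨v, Or.inr (hs v.2)⟩) fun _ => ⟨0, Or.inl rfl⟩,
    Function.extend f (fun v => a v) 0, ?_⟩
  rw [vecMul_eq_sum, ← Finset.sum_coe_sort]
  refine Fintype.sum_of_injective f f.injective _ _ (fun k hk => ?_) fun v => ?_
  · simp [Function.extend_apply' _ _ _ hk]
  · ext i
    simp [f.injective.extend_apply]

theorem linearIndependent_toR_of_det_ne_zero {d : ℕ} {y : Fin d → Fin d → ℤ}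
    (h : (Matrix.of y).det ≠ 0) : LinearIndependent ℝ fun k => toR (y k) := by
  have hdet : ((Matrix.of y).map (Int.cast : ℤ → ℝ)).det ≠ 0 := by
    rw [← Int.cast_det]
    exact_mod_cast h
  exact Matrix.linearIndependent_rows_of_det_ne_zero hdet

open Matrix in
/-- If infinitely many points `x + m (K x + z)` are nonnegative integral combinations of the rows
of a nonsingular matrix whose determinant divides `m`, then so is `x`. -/
theorem exists_eq_vecMul_of_infinite {d : ℕ} {Y : Matrix (Fin d) (Fin d) ℤ} (hdet : Y.det ≠ 0)
    {m : ℕ} (hm : 0 < m) (hdvd : Y.det ∣ m) {x z : Fin d → ℤ} {T : Set ℕ} (hT : T.Infinite)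
    (h : ∀ K ∈ T, ∃ a : Fin d → ℕ, x + m • (K • x + z) = (fun k => (a k : ℤ)) ᵥ* Y) :
    ∃ a : Fin d → ℕ, x = (fun k => (a k : ℤ)) ᵥ* Y := by
  set c : (Fin d → ℤ) → Fin d → ℤ := fun v => v ᵥ* Y.adjugate with hc
  obtain ⟨q, hq⟩ := hdvd
  have key : ∀ K ∈ T, ∀ k, ∃ n : ℕ, c x k + m * (K * c x k + c z k) = Y.det * n := by
    intro K hK k
    obtain ⟨a, ha⟩ := h K hK
    refine ⟨a k, ?_⟩
    have := congrFun (congrArg c ha) k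
    simp only [hc, ← natCast_zsmul, add_vecMul, smul_vecMul, vecMul_vecMul, mul_adjugate,
      vecMul_smul, vecMul_one, Pi.add_apply, Pi.smul_apply, smul_eq_mul] at this
    exact this
  have hb : ∀ k, ∃ b : ℕ, c x k = Y.det * b := by
    intro k
    obtain ⟨K₀, hK₀⟩ := hT.nonempty
    obtain ⟨n, hn⟩ := key K₀ hK₀ k
    obtain ⟨b, hbk⟩ : Y.det ∣ c x k :=
      ⟨n - q * (K₀ * c x k + c z k), by rw [hq] at hn; linear_combination hn⟩
    suffices 0 ≤ b by lift b to ℕ using this; exact ⟨b, hbk⟩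
    by_contra! hneg
    obtain ⟨K, hK, hlt⟩ := hT.exists_gt (q * c z k).natAbs
    obtain ⟨n, hn⟩ := key K hK k
    have hn' : b + m * K * b + q * c z k = n := by
      refine mul_left_cancel₀ hdet ?_
      rw [hbk] at hn
      linear_combination hn - c z k * hq
    have h1 : (K : ℤ) ≤ m * K := by exact_mod_cast Nat.le_mul_of_pos_left K hm
    have h2 : (m : ℤ) * K * b ≤ -(m * K) := by nlinarith
    omega
  choose b hb using hb
  refine ⟨b, ?_⟩
  have hx : Y.det • x = Y.det • ((fun k => (b k : ℤ)) ᵥ* Y) := by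
    have hcx : c x = Y.det • fun k => (b k : ℤ) := funext hb
    rw [← smul_vecMul, ← hcx, hc, vecMul_vecMul, adjugate_mul, vecMul_smul, vecMul_one]
  exact smul_right_injective _ hdet hx

open Matrix in
/-- Under (ICP) every element is a combination of the rows of a nonsingular matrix. -/
theorem ICPmonoid.exists_vecMul_det_ne_zero {d : ℕ} {M : AddSubmonoid (Fin d → ℤ)}
    (hICP : ICPmonoid M) (hFG : M.FG)
    (hgp : AddSubgroup.closure (M : Set (Fin d → ℤ)) = ⊤) {x : Fin d → ℤ} (hx : x ∈ M) :
    ∃ y : Fin d → (insert 0 (hilbM M) : Set (Fin d → ℤ)),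
      (Matrix.of fun k => (y k : Fin d → ℤ)).det ≠ 0 ∧
      ∃ a : Fin d → ℕ, x = (fun k => (a k : ℤ)) ᵥ* Matrix.of fun k => (y k : Fin d → ℤ) := by
  classical
  have : Finite (insert 0 (hilbM M) : Set (Fin d → ℤ)) := ((hilbM_finite hFG).insert 0).to_subtype
  have := Fintype.ofFinite (Fin d → (insert 0 (hilbM M) : Set (Fin d → ℤ)))
  let Y (y : Fin d → (insert 0 (hilbM M) : Set (Fin d → ℤ))) : Matrix (Fin d) (Fin d) ℤ :=
    Matrix.of fun k => (y k : Fin d → ℤ)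
  have hw (y) (hy : (Y y).det = 0) : ∃ w : Fin d → ℤ, w ≠ 0 ∧ Y y *ᵥ w = 0 :=
    Matrix.exists_mulVec_eq_zero_iff.2 hy
  choose! w hw0 hw using hw
  obtain ⟨z, hz, hzw⟩ := exists_mem_forall_dotProduct_ne_zero hgp
    ((Finset.univ.filter fun y => (Y y).det = 0).image w) (by simpa using hw0)
  replace hzw (y) (hy : (Y y).det = 0) : w y ⬝ᵥ z ≠ 0 :=
    hzw (w y) (Finset.mem_image_of_mem w (by simpa using hy))
  set m : ℕ := ∏ y with (Y y).det ≠ 0, (Y y).det.natAbs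
  have hm : 0 < m := Finset.prod_pos fun y hy => Int.natAbs_pos.2 (Finset.mem_filter.1 hy).2
  have hp (K : ℕ) : x + m • (K • x + z) ∈ M :=
    M.add_mem hx (M.nsmul_mem (M.add_mem (M.nsmul_mem hx K) hz) m)
  choose y a hya using fun K => hICP.exists_vecMul (hp K)
  obtain ⟨y₀, hy₀⟩ := Finite.exists_infinite_fiber y
  have hT : (y ⁻¹' {y₀}).Infinite := Set.infinite_coe_iff.1 hy₀
  have hrep : ∀ K ∈ y ⁻¹' {y₀}, ∃ a : Fin d → ℕ,
      x + m • (K • x + z) = (fun k => (a k : ℤ)) ᵥ* Y y₀ := by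
    rintro K rfl
    exact ⟨a K, hya K⟩
  have hdet : (Y y₀).det ≠ 0 := by
    intro h0
    have hzero : ∀ K ∈ y ⁻¹' {y₀}, w y₀ ⬝ᵥ x + m * (K * (w y₀ ⬝ᵥ x) + w y₀ ⬝ᵥ z) = 0 := by
      intro K hK
      obtain ⟨b, hb⟩ := hrep K hK
      have := congrArg (w y₀ ⬝ᵥ ·) hb
      simp only [← natCast_zsmul, dotProduct_add, dotProduct_smul, smul_eq_mul] at this
      rw [this, dotProduct_comm, ← Matrix.dotProduct_mulVec, hw y₀ h0, dotProduct_zero]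
    obtain ⟨K₁, hK₁⟩ := hT.nonempty
    obtain ⟨K₂, hK₂, hlt⟩ := hT.exists_gt K₁
    have hm' : (m : ℤ) ≠ 0 := by exact_mod_cast hm.ne'
    have hK : (K₂ : ℤ) - K₁ ≠ 0 := by omega
    have hwx : w y₀ ⬝ᵥ x = 0 := by
      refine (mul_eq_zero.1 ?_).resolve_left (mul_ne_zero hm' hK)
      linear_combination hzero K₂ hK₂ - hzero K₁ hK₁
    have := hzero K₁ hK₁
    simp only [hwx, mul_zero, zero_add, mul_eq_zero, hm', false_or] at this
    exact hzw y₀ h0 this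
  have hdvd : (Y y₀).det ∣ m := Int.dvd_natCast.2 <|
    Finset.dvd_prod_of_mem (fun y => (Y y).det.natAbs) (by simpa using hdet)
  exact ⟨y₀, hdet, exists_eq_vecMul_of_infinite hdet hm hdvd hT hrep⟩

/-- Theorem 3.2, second part: if a positive affine monoid `M ⊆ ℤ^d` with
`gp(M) = ℤ^d` satisfies (ICP), then every element of `M` is f-covered: it is a
nonnegative integral combination of `d` linearly independent elements of
`Hilb(M)`. -/
theorem fcovered_of_ICP {d : ℕ} (M : AddSubmonoid (Fin d → ℤ))
    (hFG : M.FG) (hpos : ∀ x ∈ M, -x ∈ M → x = 0)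
    (hgp : AddSubgroup.closure (M : Set (Fin d → ℤ)) = ⊤)
    (hICP : ICPmonoid M) :
    ∀ x ∈ M, ∃ y : Fin d → (Fin d → ℤ),
      (∀ k, y k ∈ hilbM M) ∧ LinearIndependent ℝ (fun k => toR (y k)) ∧
      ∃ a : Fin d → ℕ, x = ∑ k, a k • y k := by
  intro x hx
  obtain ⟨y, hdet, a, rfl⟩ := hICP.exists_vecMul_det_ne_zero hFG hgp hx
  refine ⟨fun k => y k, fun k => (y k).2.resolve_left fun hk => ?_,
    linearIndependent_toR_of_det_ne_zero hdet, a, ?_⟩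
  · exact hdet (Matrix.det_eq_zero_of_row_eq_zero k (congrFun hk))
  · ext i
    simp [Matrix.vecMul_eq_sum]
end

section
/- Let $C_{10}\subseteq\mathbb{R}^6$ be the cone generated by $z_1=(0,1,0,0,0,0)$, $z_2=(0,0,1,0,0,0)$, $z_3=(0,0,0,1,0,0)$, $z_4=(0,0,0,0,1,0)$, $z_5=(0,0,0,0,0,1)$, $z_6=(1,0,2,1,1,2)$, $z_7=(1,2,0,2,1,1)$, $z_8=(1,1,2,0,2,1)$, $z_9=(1,1,1,2,0,2)$, $z_{10}=(1,2,1,1,2,0)$. Then $C_{10}$ fails (UHC): there exists a point $x\in C_{10}$ that lies in no cone generated by six of the vectors $z_1,\dots,z_{10}$ forming a $\mathbb{Z}$-basis of $\mathbb{Z}^6$. -/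
/-- The ten generators of the cone `C₁₀`. -/
def z : Fin 10 → (Fin 6 → ℤ) :=
  ![![0, 1, 0, 0, 0, 0],
    ![0, 0, 1, 0, 0, 0],
    ![0, 0, 0, 1, 0, 0],
    ![0, 0, 0, 0, 1, 0],
    ![0, 0, 0, 0, 0, 1],
    ![1, 0, 2, 1, 1, 2],
    ![1, 2, 0, 2, 1, 1],
    ![1, 1, 2, 0, 2, 1],
    ![1, 1, 1, 2, 0, 2],
    ![1, 2, 1, 1, 2, 0]]

/-- Pairs `(T, f)` of a set of indices and an integral linear form that is nonnegative at the
generators indexed by `T` and negative at the point `(9, 13, 13, 13, 13, 13)`. -/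
def separatingForms : List (Finset (Fin 10) × (Fin 6 → ℤ)) :=
  [({0, 1, 2, 3, 4, 6, 8, 9}, ![-3, 1, 0, 1, 0, 0]),
    ({0, 1, 2, 3, 4, 6, 7, 9}, ![-3, 1, 0, 0, 1, 0]),
    ({0, 1, 2, 3, 4, 5, 7, 9}, ![-3, 0, 1, 0, 1, 0]),
    ({0, 1, 2, 3, 4, 5, 7, 8}, ![-3, 0, 1, 0, 0, 1]),
    ({0, 1, 2, 3, 4, 5, 6, 8}, ![-3, 0, 0, 1, 0, 1]),
    ({0, 1, 4, 5, 6, 7, 8, 9}, ![4, 1, 0, -2, -2, 0]),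
    ({0, 1, 2, 5, 6, 7, 8, 9}, ![4, 0, 1, 0, -2, -2]),
    ({0, 3, 4, 5, 6, 7, 8, 9}, ![4, 0, -2, -2, 0, 1]),
    ({1, 2, 3, 5, 6, 7, 8, 9}, ![4, -2, 0, 1, 0, -2]),
    ({2, 3, 4, 5, 6, 7, 8, 9}, ![4, -2, -2, 0, 1, 0])]

/-- Triples `(T, p, g)` of a set of indices, a modulus and an integral linear form that is
nonzero modulo `p` but vanishes modulo `p` at the generators indexed by `T`. -/
def modularForms : List (Finset (Fin 10) × ℤ × (Fin 6 → ℤ)) :=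
  [({0, 1, 2, 3, 5, 8, 9}, 2, ![0, 0, 0, 0, 0, 1]),
    ({0, 1, 2, 4, 7, 8, 9}, 2, ![0, 0, 0, 0, 1, 0]),
    ({0, 1, 3, 4, 6, 7, 8}, 2, ![0, 0, 0, 1, 0, 0]),
    ({0, 2, 3, 4, 5, 6, 7}, 2, ![0, 0, 1, 0, 0, 0]),
    ({1, 2, 3, 4, 5, 6, 9}, 2, ![0, 1, 0, 0, 0, 0]),
    ({0, 1, 3, 5, 6, 7, 9}, 2, ![1, 0, 0, 1, 0, 1]),
    ({0, 2, 3, 6, 7, 8, 9}, 2, ![1, 0, 1, 0, 0, 1]),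
    ({0, 2, 4, 5, 6, 8, 9}, 2, ![1, 0, 1, 0, 1, 0]),
    ({1, 2, 4, 5, 6, 7, 8}, 2, ![1, 1, 0, 0, 1, 0]),
    ({1, 3, 4, 5, 7, 8, 9}, 2, ![1, 1, 0, 1, 0, 0]),
    ({0, 1, 3, 7, 8, 9}, 3, ![1, 0, 0, 2, 0, 2]),
    ({0, 2, 3, 5, 6, 9}, 3, ![1, 0, 2, 0, 0, 2]),
    ({0, 2, 4, 6, 7, 8}, 3, ![1, 0, 2, 0, 2, 0]),
    ({1, 2, 4, 5, 8, 9}, 3, ![1, 2, 0, 0, 2, 0]),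
    ({1, 3, 4, 5, 6, 7}, 3, ![1, 2, 0, 2, 0, 0])]

theorem separatingForms_spec :
    ∀ q ∈ separatingForms,
      (∀ i ∈ q.1, 0 ≤ q.2 ⬝ᵥ z i) ∧ q.2 ⬝ᵥ ![9, 13, 13, 13, 13, 13] < 0 := by
  decide +kernel

theorem modularForms_spec :
    ∀ q ∈ modularForms, (∀ i ∈ q.1, q.2.1 ∣ q.2.2 ⬝ᵥ z i) ∧ ∃ j, ¬ q.2.1 ∣ q.2.2 j := by
  decide +kernel

theorem exists_forall_mem_of_mem_sublistsLen :
    ∀ l ∈ List.sublistsLen 6 (List.finRange 10),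
      (∃ q ∈ separatingForms, ∀ i ∈ l, i ∈ q.1) ∨ ∃ q ∈ modularForms, ∀ i ∈ l, i ∈ q.1 := by
  decide +kernel

/-- Six of the generators either lie in a half-space missing `(9, 13, 13, 13, 13, 13)` or
satisfy a nontrivial linear congruence. -/
theorem exists_subset_of_card_eq_six {S : Finset (Fin 10)} (hS : S.card = 6) :
    (∃ q ∈ separatingForms, S ⊆ q.1) ∨ ∃ q ∈ modularForms, S ⊆ q.1 := by
  have hlen : ((List.finRange 10).filter (· ∈ S)).length = 6 := by
    rw [← List.toFinset_card_of_nodup ((List.nodup_finRange 10).filter _), ← hS]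
    congr 1
    ext i
    simp
  simpa [Finset.subset_iff] using exists_forall_mem_of_mem_sublistsLen _
    (List.mem_sublistsLen.2 ⟨List.filter_sublist, hlen⟩)

/-- A linear form that is nonnegative on the generators of a cone is nonnegative on its
integral points. -/
theorem dotProduct_nonneg_of_mem_coneFin {d n : ℕ} {v : Fin n → (Fin d → ℤ)} {f x : Fin d → ℤ}
    (hf : ∀ k, 0 ≤ f ⬝ᵥ v k) (hx : toR x ∈ coneFin v) : 0 ≤ f ⬝ᵥ x := by
  obtain ⟨a, ha, hxa⟩ := hx
  have cast_dotProduct (w : Fin d → ℤ) : toR f ⬝ᵥ toR w = ((f ⬝ᵥ w : ℤ) : ℝ) := by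
    simp [dotProduct, toR]
  have h : (0 : ℝ) ≤ toR f ⬝ᵥ toR x := by
    rw [hxa, dotProduct_sum]
    refine Finset.sum_nonneg fun k _ => ?_
    rw [dotProduct_smul, cast_dotProduct]
    exact mul_nonneg (ha k) (by exact_mod_cast hf k)
  rw [cast_dotProduct] at h
  exact_mod_cast h

/-- A linear form all of whose values on a generating set of `ℤ^d` are divisible by `p` has
all coefficients divisible by `p`. -/
theorem dvd_of_closure_eq_top {d : ℕ} {s : Set (Fin d → ℤ)} (hs : AddSubgroup.closure s = ⊤)
    {p : ℤ} {g : Fin d → ℤ} (hg : ∀ w ∈ s, p ∣ g ⬝ᵥ w) (j : Fin d) : p ∣ g j := by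
  have h (w : Fin d → ℤ) : p ∣ g ⬝ᵥ w := by
    have hw : w ∈ AddSubgroup.closure s := hs ▸ AddSubgroup.mem_top w
    induction hw using AddSubgroup.closure_induction with
    | mem w hw => exact hg w hw
    | zero => simp
    | add u v _ _ hu hv => rw [dotProduct_add]; exact dvd_add hu hv
    | neg u _ hu => rw [dotProduct_neg]; exact dvd_neg.2 hu
  simpa using h (Pi.single j 1)

/-- `C₁₀` fails (UHC): some point of `C₁₀` lies in no cone generated by six of
the vectors `z₁, …, z₁₀` forming a `ℤ`-basis of `ℤ⁶`. -/
theorem C10_fails_UHC :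
    ∃ x ∈ coneFin z, ∀ y : Fin 6 → (Fin 6 → ℤ),
      (∀ k, ∃ i, y k = z i) →
      LinearIndependent ℤ y →
      AddSubgroup.closure (Set.range y) = ⊤ →
      x ∉ coneFin y := by
  refine ⟨toR ![9, 13, 13, 13, 13, 13], ?_, ?_⟩
  · refine ⟨![3, 2, 2, 3, 1, 2, 2, 2, 2, 1], fun i => by fin_cases i <;> simp, ?_⟩
    ext j
    fin_cases j <;> norm_num [Fin.sum_univ_succ, toR, z]
  intro y hy _ hspan hx
  choose i hi using hy
  obtain ⟨S, hiS, -, hS⟩ := Finset.exists_subsuperset_card_eq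
    (Finset.subset_univ (Finset.univ.image i))
    (Finset.card_image_le.trans_eq (Finset.card_fin 6)) (by simp)
  have hmem (k) : i k ∈ S := hiS (Finset.mem_image_of_mem i (Finset.mem_univ k))
  rcases exists_subset_of_card_eq_six hS with ⟨q, hq, hSq⟩ | ⟨q, hq, hSq⟩
  · obtain ⟨hpos, hneg⟩ := separatingForms_spec q hq
    refine hneg.not_ge (dotProduct_nonneg_of_mem_coneFin (fun k => ?_) hx)
    rw [hi]
    exact hpos _ (hSq (hmem k))
  · obtain ⟨hdvd, j, hj⟩ := modularForms_spec q hq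
    refine hj (dvd_of_closure_eq_top hspan ?_ j)
    rintro _ ⟨k, rfl⟩
    rw [hi]
    exact hdvd _ (hSq (hmem k))
end

section
/- Let $C_{10}\subseteq\mathbb{R}^6$ be the cone generated by $z_1=(0,1,0,0,0,0)$, $z_2=(0,0,1,0,0,0)$, $z_3=(0,0,0,1,0,0)$, $z_4=(0,0,0,0,1,0)$, $z_5=(0,0,0,0,0,1)$, $z_6=(1,0,2,1,1,2)$, $z_7=(1,2,0,2,1,1)$, $z_8=(1,1,2,0,2,1)$, $z_9=(1,1,1,2,0,2)$, $z_{10}=(1,2,1,1,2,0)$. Then $C_{10}$ fails the integral Carathéodory property: there exists a lattice point $x\in C_{10}\cap\mathbb{Z}^6$ such that for every representation $x=\sum_{i=1}^{10} a_i z_i$ with $a_1,\dots,a_{10}$ nonnegative integers, at least seven of the coefficients $a_i$ are nonzero. -/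
/-- If multiplicities `b₀, …, b₄` of `z 5, …, z 9` leave nonnegative slacks in the last five
coordinates of `(11, 15, 15, 15, 15, 15)`, then at least seven of the multiplicities and slacks
are nonzero. -/
def ManyNonzero (b₀ b₁ b₂ b₃ b₄ : ℕ) : Prop :=
  2 * b₁ + b₂ + b₃ + 2 * b₄ ≤ 15 ∧ 2 * b₀ + 2 * b₂ + b₃ + b₄ ≤ 15 ∧
    b₀ + 2 * b₁ + 2 * b₃ + b₄ ≤ 15 ∧ b₀ + b₁ + 2 * b₂ + 2 * b₄ ≤ 15 ∧
    2 * b₀ + b₁ + b₂ + 2 * b₃ ≤ 15 →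
    7 ≤ (if 2 * b₁ + b₂ + b₃ + 2 * b₄ = 15 then 0 else 1) +
      (if 2 * b₀ + 2 * b₂ + b₃ + b₄ = 15 then 0 else 1) +
      (if b₀ + 2 * b₁ + 2 * b₃ + b₄ = 15 then 0 else 1) +
      (if b₀ + b₁ + 2 * b₂ + 2 * b₄ = 15 then 0 else 1) +
      (if 2 * b₀ + b₁ + b₂ + 2 * b₃ = 15 then 0 else 1) +
      (if b₀ = 0 then 0 else 1) + (if b₁ = 0 then 0 else 1) + (if b₂ = 0 then 0 else 1) +
      (if b₃ = 0 then 0 else 1) + (if b₄ = 0 then 0 else 1)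

instance (b₀ b₁ b₂ b₃ b₄ : ℕ) : Decidable (ManyNonzero b₀ b₁ b₂ b₃ b₄) := by
  unfold ManyNonzero
  infer_instance

theorem manyNonzero_of_sum_eq : ∀ b₀ < 12, ∀ b₁ < 12 - b₀, ∀ b₂ < 12 - b₀ - b₁,
    ∀ b₃ < 12 - b₀ - b₁ - b₂, ManyNonzero b₀ b₁ b₂ b₃ (11 - b₀ - b₁ - b₂ - b₃) := by
  decide +kernel

/-- `C₁₀` fails (ICP): there is a lattice point of `C₁₀` such that every
representation as a nonnegative integral combination of `z₁, …, z₁₀` uses at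
least seven nonzero coefficients. -/
theorem C10_fails_ICP :
    ∃ x : Fin 6 → ℤ, toR x ∈ coneFin z ∧
      ∀ a : Fin 10 → ℕ, x = ∑ i, a i • z i →
        7 ≤ (Finset.univ.filter fun i => a i ≠ 0).card := by
  refine ⟨![11, 15, 15, 15, 15, 15], ?_, fun a ha => ?_⟩
  · refine ⟨![9/5, 9/5, 9/5, 9/5, 9/5, 11/5, 11/5, 11/5, 11/5, 11/5], ?_, ?_⟩
    · intro i
      fin_cases i <;> norm_num
    · ext j
      fin_cases j <;> simp [toR, z, Fin.sum_univ_succ] <;> norm_num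
  · have h0 := congrFun ha 0
    have h1 := congrFun ha 1
    have h2 := congrFun ha 2
    have h3 := congrFun ha 3
    have h4 := congrFun ha 4
    have h5 := congrFun ha 5
    simp [z, Fin.sum_univ_succ] at h0 h1 h2 h3 h4 h5
    have key := manyNonzero_of_sum_eq (a 5) (by lia) (a 6) (by lia) (a 7) (by lia) (a 8) (by lia)
    rw [show 11 - a 5 - a 6 - a 7 - a 8 = a 9 by lia] at key
    have hcount := key (by lia)
    rw [Finset.card_filter]
    simp [Fin.sum_univ_succ]
    grind
end
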